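/- arXiv:1611.10278 — 3 statements merged into one kernel-verified Lean document; each statement's English description precedes it below -/
import Mathlib

section
/- Let k be a field and let Σ be a central simple algebra over k whose degree is prime to the characteristic of k. Then Σ is finitely generated over k — i.e. there exists a finitely generated k-subalgebra S ⊆ Σ such that every element of Σ can be written as z⁻¹s with s ∈ S and z a nonzero element of S ∩ Z(Σ) — if and only if the centre Z(Σ) is a finitely generated field extension of k. -/
/-- The elements of a `Z`-algebra `A` whose coordinates in a basis lie in an intermediate field
`F` of `Z / k` form a `k`-subalgebra, provided `F` contains the coordinates of `1` and the
structure constants of the basis. -/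
def Module.Basis.coordSubalgebra {k Z A ι : Type*} [Field k] [Field Z] [Ring A] [Algebra k Z]
    [Algebra k A] [Algebra Z A] [IsScalarTower k Z A] [Fintype ι] (b : Module.Basis ι Z A)
    (F : IntermediateField k Z) (h1 : ∀ l, b.repr 1 l ∈ F)
    (hmul : ∀ i j l, b.repr (b i * b j) l ∈ F) : Subalgebra k A where
  carrier := {x | ∀ l, b.repr x l ∈ F}
  add_mem' := fun {x y} hx hy l ↦ by
    rw [map_add]
    exact add_mem (hx l) (hy l)
  mul_mem' := fun {x y} hx hy l ↦ by
    have key : x * y = ∑ i, ∑ j, (b.repr x i * b.repr y j) • (b i * b j) := by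
      conv_lhs => rw [← b.sum_repr x, ← b.sum_repr y]
      simp only [Finset.sum_mul_sum, smul_mul_smul_comm]
    rw [key]
    simp only [map_sum, map_smul, Finsupp.coe_finsetSum, Finset.sum_apply, Finsupp.smul_apply,
      smul_eq_mul]
    exact sum_mem fun i _ ↦ sum_mem fun j _ ↦ mul_mem (mul_mem (hx i) (hy j)) (hmul i j l)
  algebraMap_mem' := fun c l ↦ by
    rw [IsScalarTower.algebraMap_apply k Z A, Algebra.algebraMap_eq_smul_one, map_smul,
      Finsupp.smul_apply, smul_eq_mul]
    exact mul_mem (F.algebraMap_mem c) (h1 l)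

/-- A scalar `ζ` lies in `F` as soon as the coordinates of `ζ` in `A` and of `1` lie in `F`. -/
theorem Module.Basis.mem_of_coord_algebraMap_mem {k Z A ι : Type*} [Field k] [Field Z] [Ring A]
    [Nontrivial A] [Algebra k Z] [Algebra Z A] (b : Module.Basis ι Z A)
    (F : IntermediateField k Z) (h1 : ∀ l, b.repr 1 l ∈ F) {ζ : Z}
    (hζ : ∀ l, b.repr (algebraMap Z A ζ) l ∈ F) : ζ ∈ F := by
  obtain ⟨l, hl⟩ : ∃ l, b.repr (1 : A) l ≠ 0 := by
    by_contra! h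
    exact one_ne_zero (b.repr.map_eq_zero_iff.mp (Finsupp.ext h))
  have h := hζ l
  rw [Algebra.algebraMap_eq_smul_one, map_smul, Finsupp.smul_apply, smul_eq_mul] at h
  simpa [hl] using div_mem h (h1 l)

/-- If `A` is the ring of central quotients of a finitely generated `k`-subalgebra, then its centre
`Z` is a finitely generated field extension of `k`. -/
theorem exists_finset_adjoin_eq_top_of_fg_central_quotients {k Z A : Type*} [Field k] [Field Z]
    [Ring A] [Nontrivial A] [Algebra k Z] [Algebra k A] [Algebra Z A] [IsScalarTower k Z A]
    [FiniteDimensional Z A] (hZ : Set.range (algebraMap Z A) = Set.center A)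
    {S : Subalgebra k A} (hS : S.FG)
    (hfrac : ∀ x : A, ∃ s ∈ S, ∃ z ∈ S, z ∈ Set.center A ∧ z ≠ 0 ∧ z * x = s) :
    ∃ t : Finset Z, IntermediateField.adjoin k (t : Set Z) = ⊤ := by
  obtain ⟨g, rfl⟩ := hS
  let b := Module.finBasis Z A
  let T : Set Z := Set.range (fun l ↦ b.repr 1 l) ∪
    Set.range (fun p : (Fin (Module.finrank Z A) × Fin (Module.finrank Z A)) ×
      Fin (Module.finrank Z A) ↦ b.repr (b p.1.1 * b p.1.2) p.2) ∪
    Set.range (fun p : g × Fin (Module.finrank Z A) ↦ b.repr (p.1 : A) p.2)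
  have hT : T.Finite :=
    ((Set.finite_range _).union (Set.finite_range _)).union (Set.finite_range _)
  refine ⟨hT.toFinset, ?_⟩
  rw [hT.coe_toFinset]
  set F := IntermediateField.adjoin k T
  have hTF : T ⊆ F := IntermediateField.subset_adjoin k T
  have h1 : ∀ l, b.repr 1 l ∈ F := fun l ↦ hTF (Or.inl (Or.inl ⟨l, rfl⟩))
  have hmul : ∀ i j l, b.repr (b i * b j) l ∈ F :=
    fun i j l ↦ hTF (Or.inl (Or.inr ⟨((i, j), l), rfl⟩))
  have hSB : Algebra.adjoin k (g : Set A) ≤ b.coordSubalgebra F h1 hmul :=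
    Algebra.adjoin_le fun x hx l ↦ hTF (Or.inr ⟨(⟨x, hx⟩, l), rfl⟩)
  refine eq_top_iff.mpr fun ζ _ ↦ ?_
  obtain ⟨s, hs, z, hz, hzc, hz0, rfl⟩ := hfrac (algebraMap Z A ζ)
  obtain ⟨w, rfl⟩ := hZ.symm ▸ hzc
  rw [← map_mul] at hs
  have hw : w ∈ F := b.mem_of_coord_algebraMap_mem F h1 (hSB hz)
  have hwζ : w * ζ ∈ F := b.mem_of_coord_algebraMap_mem F h1 (hSB hs)
  have hw0 : w ≠ 0 := by
    rintro rfl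
    exact hz0 (map_zero _)
  simpa [hw0] using div_mem hwζ hw

/-- If the centre `Z` of `A` is a finitely generated field extension of `k`, then `A` is the ring of
central quotients of a finitely generated `k`-subalgebra. -/
theorem exists_fg_central_quotients_of_adjoin_eq_top {k Z A : Type*} [Field k] [Field Z]
    [Ring A] [Nontrivial A] [Algebra k Z] [Algebra k A] [Algebra Z A] [IsScalarTower k Z A]
    [FiniteDimensional Z A] (hZ : Set.range (algebraMap Z A) = Set.center A)
    {t : Finset Z} (ht : IntermediateField.adjoin k (t : Set Z) = ⊤) :
    ∃ S : Subalgebra k A, S.FG ∧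
      ∀ x : A, ∃ s ∈ S, ∃ z ∈ S, z ∈ Set.center A ∧ z ≠ 0 ∧ z * x = s := by
  let b := Module.finBasis Z A
  let G : Set A := algebraMap Z A '' t ∪ Set.range b
  have hG : G.Finite := (t.finite_toSet.image _).union (Set.finite_range _)
  have hR : ∀ r ∈ Algebra.adjoin k (t : Set Z), algebraMap Z A r ∈ Algebra.adjoin k G := by
    have h : Algebra.adjoin k (t : Set Z) ≤
        (Algebra.adjoin k G).comap (IsScalarTower.toAlgHom k Z A) :=
      Algebra.adjoin_le fun r hr ↦ Algebra.subset_adjoin (Or.inl ⟨r, hr, rfl⟩)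
    exact fun r hr ↦ h hr
  refine ⟨Algebra.adjoin k G, ⟨hG.toFinset, by rw [hG.coe_toFinset]⟩, fun x ↦ ?_⟩
  have hfrac : IsFractionRing (Algebra.adjoin k (t : Set Z)) Z := by
    refine IsFractionRing.of_field _ _ fun z ↦ ?_
    obtain ⟨r, hr, s, hs, rfl⟩ := IntermediateField.mem_adjoin_iff_div.mp
      (ht.symm ▸ IntermediateField.mem_top : z ∈ IntermediateField.adjoin k (t : Set Z))
    exact ⟨⟨r, hr⟩, ⟨s, hs⟩, rfl⟩
  obtain ⟨q, hq⟩ := IsLocalization.exist_integer_multiples_of_finite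
    (nonZeroDivisors (Algebra.adjoin k (t : Set Z))) (b.repr x)
  have hq0 : ((q : Algebra.adjoin k (t : Set Z)) : Z) ≠ 0 := by
    simp
  refine ⟨_, ?_, algebraMap Z A (q : Algebra.adjoin k (t : Set Z)), hR _ (Subtype.property _),
    hZ ▸ ⟨_, rfl⟩, ?_, rfl⟩
  · rw [← Algebra.smul_def, ← b.sum_repr x, Finset.smul_sum]
    refine sum_mem fun i _ ↦ ?_
    obtain ⟨r, hr⟩ := hq i
    rw [smul_smul, Algebra.smul_def]
    refine mul_mem (hR _ ?_) (Algebra.subset_adjoin (Or.inr ⟨i, rfl⟩))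
    rw [← smul_eq_mul]
    exact hr ▸ r.2
  · rwa [Ne, FaithfulSMul.algebraMap_eq_zero_iff]

/-- Let `k` be a field and let `A` be a central simple algebra over `k` (a
simple `k`-algebra, finite dimensional over its centre `Z`, which is a field extension of `k`;
here the centre is witnessed by a field `Z` mapping isomorphically onto `Set.center A`) whose
degree `d` (with `d² = [A : Z]`) is prime to the characteristic of `k`.  Then `A` is finitely
generated over `k` — there exists a finitely generated `k`-subalgebra `S ⊆ A` such that every
element of `A` can be written as `z⁻¹·s` (i.e. `z·x = s`) with `s ∈ S` and `z` a nonzero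
central element of `S` — if and only if the centre `Z` is a finitely generated field extension
of `k`. -/
theorem csa_finitely_generated_iff_centre_finitely_generated
    (k : Type*) [Field k]
    (A : Type*) [Ring A] [Algebra k A] [IsSimpleRing A]
    -- `Z` is the centre of `A`, a field extension of `k`, and `A` is finite dimensional over `Z`
    (Z : Type*) [Field Z] [Algebra k Z] [Algebra Z A] [IsScalarTower k Z A]
    (hZ : Set.range (algebraMap Z A) = Set.center A)
    [FiniteDimensional Z A]
    -- the degree `d` of `A` is prime to `char k`
    (d : ℕ) (hd : d * d = Module.finrank Z A)
    (hchar : ¬ (ringChar k ∣ d)) :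
    (∃ S : Subalgebra k A, S.FG ∧
        ∀ x : A, ∃ s ∈ S, ∃ z ∈ S, z ∈ Set.center A ∧ z ≠ 0 ∧ z * x = s) ↔
      (∃ t : Finset Z, IntermediateField.adjoin k (t : Set Z) = ⊤) := by
  exact ⟨fun ⟨_, hS, hfrac⟩ ↦ exists_finset_adjoin_eq_top_of_fg_central_quotients hZ hS hfrac,
    fun ⟨_, ht⟩ ↦ exists_fg_central_quotients_of_adjoin_eq_top hZ ht⟩
end

section
/- Let k be a field and let Σ be a central simple algebra over k whose degree is prime to the characteristic of k and whose centre Z(Σ) is a finitely generated field extension of k. Then the simple k-subalgebras of Σ satisfy the ascending chain condition: every ascending chain Σ₁ ⊆ Σ₂ ⊆ ⋯ of simple k-subalgebras of Σ stabilizes. In particular, every simple k-subalgebra of Σ is a central simple algebra over k whose centre is a finitely generated field extension of k. -/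
universe u v

/-- A witness that a `k`-algebra is a central simple algebra over `k` whose centre is a
finitely generated field extension of `k`: a field `Z` mapping onto the centre, over which the
algebra is finite dimensional, and which is finitely generated as a field extension of `k`. -/
structure CentralSimpleWithFGCentre (k : Type u) [Field k] (A : Type v) [Ring A]
    [Algebra k A] where
  Z : Type v
  [fieldZ : Field Z]
  [algkZ : Algebra k Z]
  [algZA : Algebra Z A]
  [tower : IsScalarTower k Z A]
  centre_eq : Set.range (algebraMap Z A) = Set.center A
  finite : FiniteDimensional Z A
  fg : ∃ t : Finset Z, IntermediateField.adjoin k (t : Set Z) = ⊤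

open scoped TensorProduct

theorem mem_range_algebraMap_of_tmul_comm {E L : Type*} [Field E] [Ring L] [Algebra E L]
    {x : L} (h : x ⊗ₜ[E] (1 : L) = 1 ⊗ₜ[E] x) : x ∈ (algebraMap E L).range := by
  by_contra hx
  have hx' : x ∉ Submodule.span E {(1 : L)} := by
    rw [Submodule.mem_span_singleton]
    rintro ⟨a, rfl⟩
    exact hx ⟨a, Algebra.algebraMap_eq_smul_one a⟩
  obtain ⟨f, hfx, hf⟩ := Submodule.exists_le_ker_of_notMem hx'
  have h1 : f 1 = 0 := hf (Submodule.mem_span_singleton_self 1)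
  have h2 : f x • (1 : L) = f 1 • x := by
    simpa using congr(TensorProduct.lid E L (f.rTensor L $h))
  have : Nontrivial L := ⟨x, 0, fun h0 => hx ⟨0, by simp [h0]⟩⟩
  rw [h1, zero_smul] at h2
  exact hfx ((smul_eq_zero.mp h2).resolve_right one_ne_zero)

/-- Intermediate fields of a finitely generated field extension are finitely generated. -/
theorem IntermediateField.fg_of_essFiniteType {k L : Type*} [Field k] [Field L] [Algebra k L]
    [Algebra.EssFiniteType k L] (E : IntermediateField k L) : E.FG := by
  classical
  have : IsNoetherianRing (L ⊗[k] L) := Algebra.EssFiniteType.isNoetherianRing L _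
  let δ : L → L ⊗[k] L := fun x => x ⊗ₜ 1 - 1 ⊗ₜ x
  obtain ⟨t, ht, hspan⟩ := Submodule.fg_span_iff_fg_span_finset_subset (δ '' E) |>.mp
    (IsNoetherian.noetherian (Submodule.span (L ⊗[k] L) (δ '' E)))
  obtain ⟨u, hu, rfl⟩ := Finset.subset_set_image_iff.mp ht
  refine ⟨u, le_antisymm (adjoin_le_iff.mpr hu) fun x hx => ?_⟩
  let E₀ := adjoin k (u : Set L)
  let π : L ⊗[k] L →ₐ[k] L ⊗[E₀] L := Algebra.TensorProduct.lift
    ((Algebra.TensorProduct.includeLeft : L →ₐ[E₀] L ⊗[E₀] L).restrictScalars k)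
    ((Algebra.TensorProduct.includeRight : L →ₐ[E₀] L ⊗[E₀] L).restrictScalars k)
    fun _ _ => Commute.all _ _
  have hπ (y : L) : π (δ y) = y ⊗ₜ 1 - 1 ⊗ₜ y := by simp [π, δ]
  have hle : Ideal.span (δ '' E) ≤ RingHom.ker π := by
    refine hspan.trans_le (Ideal.span_le.mpr ?_)
    rintro _ hy
    obtain ⟨y, hyu, rfl⟩ := Finset.mem_image.mp hy
    have hy₀ : y ∈ E₀ := subset_adjoin k _ hyu
    rw [SetLike.mem_coe, RingHom.mem_ker, hπ, sub_eq_zero]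
    have := TensorProduct.smul_tmul (R := E₀) (⟨y, hy₀⟩ : E₀) (1 : L) (1 : L)
    simpa [Algebra.smul_def] using this
  have hxker : π (δ x) = 0 := hle (Ideal.subset_span ⟨x, hx, rfl⟩)
  rw [hπ, sub_eq_zero] at hxker
  obtain ⟨y, hy⟩ := mem_range_algebraMap_of_tmul_comm hxker
  exact hy ▸ y.2

theorem Algebra.EssFiniteType.of_algHom_field {k F L : Type*} [Field k] [Field F] [Field L]
    [Algebra k F] [Algebra k L] [Algebra.EssFiniteType k L] (f : F →ₐ[k] L) :
    Algebra.EssFiniteType k F := by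
  have : Algebra.EssFiniteType k f.range :=
    IntermediateField.essFiniteType_iff.mpr f.fieldRange.fg_of_essFiniteType
  exact (Algebra.EssFiniteType.iff_of_algEquiv (AlgEquiv.ofInjectiveField f)).mpr this

theorem Algebra.EssFiniteType.of_algHom_finite_algebra {k F Z A : Type*} [Field k] [Field F]
    [Field Z] [Ring A] [Nontrivial A] [Algebra k F] [Algebra k Z] [Algebra k A] [Algebra Z A]
    [IsScalarTower k Z A] [FiniteDimensional Z A] [Algebra.EssFiniteType k Z] (f : F →ₐ[k] A) :
    Algebra.EssFiniteType k F := by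
  let g : Z ⊗[k] F →ₐ[Z] A := Algebra.TensorProduct.lift (Algebra.ofId Z A) f
    fun z _ => Algebra.commutes z _
  obtain ⟨m, hm, hle⟩ := Ideal.exists_le_maximal (RingHom.ker g) (RingHom.ker_ne_top g)
  let L := (Z ⊗[k] F) ⧸ m
  let : Field L := Ideal.Quotient.field m
  have : Module.Finite Z ((Z ⊗[k] F) ⧸ RingHom.ker g) :=
    .of_injective (Ideal.kerLiftAlg g).toLinearMap (Ideal.kerLiftAlg_injective g)
  have : Module.Finite Z L := .of_surjective (Ideal.Quotient.factorₐ Z hle).toLinearMap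
    (Ideal.Quotient.factor_surjective hle)
  have : Algebra.EssFiniteType k L := .comp k Z L
  exact .of_algHom_field ((Ideal.Quotient.mkₐ k m).comp Algebra.TensorProduct.includeRight)

/-- In a central simple algebra, possibly infinite-dimensional, linearly independent elements can
be separated by the two-sided multiplications. -/
theorem exists_mulLeftRight_eq {F S : Type*} [Field F] [Ring S] [Algebra F S]
    [Algebra.IsCentral F S] [IsSimpleRing S] (f : Module.End F S) (s : Finset S) :
    ∃ t : S ⊗[F] Sᵐᵒᵖ, ∀ x ∈ s, AlgHom.mulLeftRight F S t x = f x := by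
  let R := (AlgHom.mulLeftRight F S).range
  have hmem (a b : S) : AlgHom.mulLeftRight F S (a ⊗ₜ .op b) ∈ R := ⟨_, rfl⟩
  have : IsSimpleModule R S := by
    refine isSimpleModule_iff R S |>.mpr { eq_bot_or_eq_top := fun N => ?_ }
    refine or_iff_not_imp_left.mpr fun hN => ?_
    obtain ⟨x, hxN, hx⟩ := N.exists_mem_ne_zero_of_ne_bot hN
    have hmul (a b : S) {y : S} (hy : y ∈ N) : a * y * b ∈ N := by
      simpa [Subalgebra.smul_def] using N.smul_mem ⟨_, hmem a b⟩ hy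
    let I : TwoSidedIdeal S := .mk' N N.zero_mem N.add_mem
      (fun {y} hy => by simpa using hmul (-1) 1 hy)
      (fun {a _} hy => by simpa using hmul a 1 hy) (fun {_ b} hy => by simpa using hmul 1 b hy)
    have h1 : (1 : S) ∈ N := by
      simpa [I] using IsSimpleRing.one_mem_of_ne_zero_mem I hx (by simpa [I] using hxN)
    exact eq_top_iff.mpr fun y _ => by simpa using hmul y 1 h1
  have hcomm (g : Module.End R S) : ∃ c : F, ∀ x, g x = c • x := by
    have hg (a b y : S) : g (a * y * b) = a * g y * b := by
      simpa [Subalgebra.smul_def] using g.map_smul ⟨_, hmem a b⟩ y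
    have hl (x : S) : g x = x * g 1 := by simpa using hg x 1 1
    have hr (x : S) : g x = g 1 * x := by simpa using hg 1 x 1
    obtain ⟨c, hc⟩ := Algebra.mem_bot.mp (Algebra.IsCentral.out (K := F)
      (Subalgebra.mem_center_iff.mpr fun x => (hl x).symm.trans (hr x)))
    exact ⟨c, fun x => by rw [hr, ← hc, Algebra.smul_def]⟩
  let f' : Module.End (Module.End R S) S :=
    { toFun := f
      map_add' := map_add f
      map_smul' := fun g x => by
        obtain ⟨c, hc⟩ := hcomm g
        simp [hc] }
  obtain ⟨⟨_, t, rfl⟩, ht⟩ := jacobson_density (R := R) f' s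
  exact ⟨t, fun x hx => (ht x hx).symm⟩

/-- Elements of a central simple `F`-algebra `S` that are linearly independent over `F` remain
linearly independent over `Z` in any `Z`-algebra to which `S` maps. -/
theorem LinearIndependent.map_of_isCentral_of_isSimpleRing {F S Z A ι : Type*} [Field F] [Ring S]
    [Algebra F S] [Algebra.IsCentral F S] [IsSimpleRing S] [CommRing Z] [Ring A] [Algebra Z A]
    [FaithfulSMul Z A] (φ : S →+* A) {v : ι → S} (hv : LinearIndependent F v) :
    LinearIndependent Z (φ ∘ v) := by
  classical
  rw [linearIndependent_iff']
  intro s z hz i hi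
  have key (t : S ⊗[F] Sᵐᵒᵖ) : ∑ j ∈ s, z j • φ (AlgHom.mulLeftRight F S t (v j)) = 0 := by
    induction t with
    | zero => simp
    | add t u ht hu => simp [smul_add, Finset.sum_add_distrib, ht, hu]
    | tmul a b =>
      simpa [Finset.mul_sum, Finset.sum_mul] using congr(φ a * $hz * φ b.unop)
  obtain ⟨f, hf⟩ : ∃ f : Module.End F S, ∀ j, f (v j) = if j = i then 1 else 0 := by
    obtain ⟨f, hf⟩ := LinearMap.exists_extend
      ((LinearMap.toSpanSingleton F S 1).comp ((Finsupp.lapply i).comp hv.repr))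
    refine ⟨f, fun j => ?_⟩
    let w : Submodule.span F (Set.range v) := ⟨v j, Submodule.subset_span ⟨j, rfl⟩⟩
    have := congr($hf w)
    simpa [w, hv.repr_eq_single j w rfl, Finsupp.single_apply, ite_smul] using this
  obtain ⟨t, ht⟩ := exists_mulLeftRight_eq f (s.image v)
  have := key t
  rw [Finset.sum_congr rfl fun j hj => by rw [ht _ (Finset.mem_image_of_mem v hj), hf]] at this
  simpa [hi, apply_ite φ, ← Algebra.algebraMap_eq_smul_one] using this

theorem Module.Finite.of_isCentral_of_isSimpleRing {F S Z A : Type*} [Field F] [Ring S]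
    [Algebra F S] [Algebra.IsCentral F S] [IsSimpleRing S] [Field Z] [Ring A] [Nontrivial A]
    [Algebra Z A] [FiniteDimensional Z A] (φ : S →+* A) : Module.Finite F S := by
  let b := Module.Basis.ofVectorSpace F S
  have := (b.linearIndependent.map_of_isCentral_of_isSimpleRing (Z := Z) φ).finite
  exact .of_basis b

theorem CentralSimpleWithFGCentre.nonempty_of_algHom {k : Type u} {Z A : Type*} {S : Type v}
    [Field k] [Ring S] [Algebra k S] [IsSimpleRing S] [Field Z] [Ring A] [Nontrivial A]
    [Algebra k A] [Algebra k Z] [Algebra Z A] [IsScalarTower k Z A] [FiniteDimensional Z A]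
    [Algebra.EssFiniteType k Z] (φ : S →ₐ[k] A) : Nonempty (CentralSimpleWithFGCentre k S) := by
  obtain ⟨F, _, ⟨e⟩⟩ : ∃ (F : Type v) (_ : Field F), Nonempty (F ≃+* Subring.center S) :=
    ⟨_, (IsSimpleRing.isField_center S).toField, ⟨.refl _⟩⟩
  let j : k →+* Subring.center S := (algebraMap k S).codRestrict _ fun r =>
    Subring.mem_center_iff.mpr fun x => (Algebra.commutes r x).symm
  let : Algebra k F := (e.symm.toRingHom.comp j).toAlgebra
  let : Algebra F S := ((Subring.center S).subtype.comp e.toRingHom).toAlgebra' fun c x =>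
    (Subring.mem_center_iff.mp (e c).2 x).symm
  have hF (c : F) : algebraMap F S c = e c := rfl
  have : IsScalarTower k F S := .of_algebraMap_eq fun r =>
    (congrArg Subtype.val (e.apply_symm_apply (j r))).symm
  have hcentre : Set.range (algebraMap F S) = Set.center S := by
    refine Set.Subset.antisymm (Set.range_subset_iff.mpr fun c => (e c).2) fun x hx => ?_
    exact ⟨e.symm ⟨x, hx⟩, by simp [hF]⟩
  have : Algebra.IsCentral F S := ⟨hcentre.ge⟩
  have : Algebra.EssFiniteType k F :=
    .of_algHom_finite_algebra (Z := Z) (φ.comp (IsScalarTower.toAlgHom k F S))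
  exact ⟨{
    Z := F
    centre_eq := hcentre
    finite := .of_isCentral_of_isSimpleRing (Z := Z) φ.toRingHom
    fg := IntermediateField.fg_top k F }⟩

/-- A simple subalgebra contains the inverses of its elements which are central in the
whole algebra. -/
theorem Subalgebra.algebraMap_inv_mem {k F S : Type*} [Field k] [Field F] [Ring S] [Algebra k S]
    [Algebra F S] (B : Subalgebra k S) [IsSimpleRing B] {z : F}
    (hz : algebraMap F S z ∈ B) : algebraMap F S z⁻¹ ∈ B := by
  rcases eq_or_ne z 0 with rfl | hz0
  · simp
  have : Nontrivial S := Subtype.val_injective.nontrivial (α := B)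
  let x : Subring.center B := ⟨⟨_, hz⟩, Subring.mem_center_iff.mpr fun b =>
    Subtype.ext (Algebra.commutes z (b : S)).symm⟩
  have hx : x ≠ 0 := fun h => hz0 (by simpa [x] using congr((($h : B) : S)))
  obtain ⟨y, hy⟩ := (IsSimpleRing.isField_center B).mul_inv_cancel hx
  have hy' : algebraMap F S z * (y : B) = 1 := congr((($hy : B) : S))
  have hzz : algebraMap F S z⁻¹ * algebraMap F S z = 1 := by simp [← map_mul, hz0]
  exact left_inv_eq_right_inv hzz hy' ▸ (y : B).2

theorem CentralSimpleWithFGCentre.exists_finset_eq_top {k : Type u} {S : Type v} [Field k]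
    [Ring S] [Algebra k S] (W : CentralSimpleWithFGCentre k S) :
    ∃ s : Finset S, ∀ B : Subalgebra k S, IsSimpleRing B → (s : Set S) ⊆ B → B = ⊤ := by
  classical
  obtain ⟨Z, _, finite, t, ht⟩ := W
  obtain ⟨b, hb⟩ := finite.fg_top
  refine ⟨b ∪ t.image (algebraMap Z S), fun B _ hB => ?_⟩
  rw [Finset.coe_union, Finset.coe_image, Set.union_subset_iff, Set.image_subset_iff] at hB
  let E : IntermediateField k Z :=
    { B.comap (IsScalarTower.toAlgHom k Z S) with
      inv_mem' := fun z hz => B.algebraMap_inv_mem hz }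
  have hE : E = ⊤ := top_le_iff.mp (ht ▸ IntermediateField.adjoin_le_iff.mpr hB.2)
  have hZB (z : Z) : algebraMap Z S z ∈ B := (hE ▸ IntermediateField.mem_top : z ∈ E)
  refine eq_top_iff.mpr fun x _ => ?_
  induction hb.ge (Submodule.mem_top : x ∈ ⊤) using Submodule.span_induction with
  | mem x hx => exact hB.1 hx
  | zero => exact B.zero_mem
  | add x y _ _ hx hy => exact B.add_mem (hx trivial) (hy trivial)
  | smul z x _ hx => exact Algebra.smul_def z x ▸ B.mul_mem (hZB z) (hx trivial)

theorem Subalgebra.isSimpleRing_iSup_of_directed {k A ι : Type*} [CommRing k] [Ring A]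
    [Algebra k A] [Nonempty ι] {c : ι → Subalgebra k A} (hc : Directed (· ≤ ·) c)
    (hs : ∀ i, IsSimpleRing (c i)) : IsSimpleRing (⨆ i, c i : Subalgebra k A) := by
  have : Nontrivial (⨆ i, c i : Subalgebra k A) :=
    (inclusion_injective (le_iSup c (Classical.arbitrary ι))).nontrivial
  refine .of_eq_bot_or_eq_top fun I => or_iff_not_imp_left.mpr fun hI => ?_
  obtain ⟨x, hxI, hx⟩ := SetLike.exists_of_lt (bot_lt_iff_ne_bot.mpr hI)
  obtain ⟨i, hi⟩ : ∃ i, (x : A) ∈ c i := by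
    simpa [← SetLike.mem_coe, coe_iSup_of_directed hc] using x.2
  have h1 := IsSimpleRing.one_mem_of_ne_zero_mem (I.comap (inclusion (le_iSup c i)))
    (x := ⟨x, hi⟩) (fun h => hx (Subtype.ext congr(($h : A)))) hxI
  exact I.one_mem_iff.mp ((TwoSidedIdeal.mem_comap _).mp h1)

/-- Let `k` be a field and let `A` be a central simple algebra over `k`
(with centre witnessed by a field `Z` mapping onto `Set.center A`, `A` finite dimensional over
`Z`) whose degree `d` is prime to the characteristic of `k` and whose centre `Z` is a finitely
generated field extension of `k`.  Then the simple `k`-subalgebras of `A` satisfy the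
ascending chain condition: every ascending chain `Σ₁ ⊆ Σ₂ ⊆ ⋯` of simple `k`-subalgebras of
`A` stabilizes.  In particular, every simple `k`-subalgebra of `A` is a central simple algebra
over `k` whose centre is a finitely generated field extension of `k`. -/
theorem acc_of_simple_subalgebras
    (k : Type u) [Field k]
    (A : Type v) [Ring A] [Algebra k A] [IsSimpleRing A]
    (Z : Type v) [Field Z] [Algebra k Z] [Algebra Z A] [IsScalarTower k Z A]
    (hZ : Set.range (algebraMap Z A) = Set.center A)
    [FiniteDimensional Z A]
    (d : ℕ) (hd : d * d = Module.finrank Z A)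
    (hchar : ¬ (ringChar k ∣ d))
    (hfg : ∃ t : Finset Z, IntermediateField.adjoin k (t : Set Z) = ⊤) :
    (∀ c : ℕ → Subalgebra k A, (∀ n, c n ≤ c (n + 1)) → (∀ n, IsSimpleRing (c n)) →
        ∃ N, ∀ n, N ≤ n → c n = c N) ∧
      (∀ S : Subalgebra k A, IsSimpleRing S → Nonempty (CentralSimpleWithFGCentre k S)) := by
  have : Algebra.EssFiniteType k Z := IntermediateField.fg_top_iff.mp hfg
  have hS (S : Subalgebra k A) (_ : IsSimpleRing S) :
      Nonempty (CentralSimpleWithFGCentre k S) :=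
    CentralSimpleWithFGCentre.nonempty_of_algHom (Z := Z) S.val
  refine ⟨fun c hc hs => ?_, hS⟩
  have hmono : Monotone c := monotone_nat_of_le_succ hc
  let U := ⨆ n, c n
  obtain ⟨W⟩ := hS U (Subalgebra.isSimpleRing_iSup_of_directed hmono.directed_le hs)
  obtain ⟨s, h⟩ := W.exists_finset_eq_top
  let B (n : ℕ) : Subalgebra k U := (Subalgebra.inclusion (le_iSup c n)).range
  have hBmono : Monotone fun n => (B n : Set U) := by
    rintro m n hmn _ ⟨x, rfl⟩
    exact ⟨Subalgebra.inclusion (hmono hmn) x, rfl⟩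
  have hsub : (s : Set U) ⊆ ⋃ n, (B n : Set U) := fun x _ => by
    obtain ⟨n, hn⟩ := Set.mem_iUnion.mp
      (Subalgebra.coe_iSup_of_directed hmono.directed_le ▸ x.2 : (x : A) ∈ ⋃ n, (c n : Set A))
    exact Set.mem_iUnion.mpr ⟨n, ⟨x, hn⟩, rfl⟩
  obtain ⟨N, hN⟩ := hBmono.directed_le.exists_mem_subset_of_finset_subset_biUnion hsub
  have hU (n : ℕ) (hn : N ≤ n) : c n = U := by
    refine le_antisymm (le_iSup c n) fun x hx => ?_
    have : IsSimpleRing (B n) := .of_surjective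
      (Subalgebra.inclusion (le_iSup c n)).rangeRestrict.toRingHom (hs n)
      (Subalgebra.inclusion (le_iSup c n)).rangeRestrict_surjective
    obtain ⟨y, hy⟩ := (h (B n) this (hN.trans (hBmono hn)) ▸ Algebra.mem_top :
      (⟨x, hx⟩ : U) ∈ B n)
    have hyx : (y : A) = x := congr(($hy : A))
    exact hyx ▸ y.2
  exact ⟨N, fun n hn => (hU n hn).trans (hU N le_rfl).symm⟩
end

section
/- Let k be a field, let 𝒟 be a division ring containing k in its centre and finite dimensional over its centre, and let 𝒟[t] be the polynomial ring over 𝒟, graded so that elements of 𝒟·tⁿ are homogeneous of degree n. Then every graded k-subalgebra A of 𝒟[t] satisfies the graded left Ore conditions with respect to the multiplicative set S of its nonzero homogeneous elements: (i) if r ∈ A is homogeneous, s ∈ S and rs = 0, then s'r = 0 for some s' ∈ S; and (ii) for every homogeneous r ∈ A and every s ∈ S there exist a homogeneous r' ∈ A and s' ∈ S with s'r = r's. -/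
/-- A homogeneous element of `D[t]` (graded so that `D·tⁿ` consists of the homogeneous
elements of degree `n`): a polynomial of the form `d·tⁿ`. -/
def Polynomial.IsHomogeneousElem {D : Type*} [Semiring D] (p : Polynomial D) : Prop :=
  ∃ (n : ℕ) (d : D), p = Polynomial.C d * Polynomial.X ^ n

open Polynomial

/-- The standard polynomial of degree `n`, expanded along its last factor. -/
def standardPolynomial {R : Type*} [Ring R] : (n : ℕ) → (Fin n → R) → R
  | 0, _ => 1
  | n + 1, v => ∑ i : Fin (n + 1), (-1 : ℤ) ^ (i : ℕ) • (standardPolynomial n (i.removeNth v) * v i)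

theorem map_standardPolynomial {R S : Type*} [Ring R] [Ring S] (f : R →+* S) (n : ℕ)
    (v : Fin n → R) : f (standardPolynomial n v) = standardPolynomial n fun i => f (v i) := by
  induction n with
  | zero => simp [standardPolynomial]
  | succ n ih =>
    simp only [standardPolynomial, map_sum, map_zsmul, map_mul, ih]
    rfl

/-- The standard polynomial of an algebra is an alternating multilinear map. -/
theorem exists_alternatingMap_eq_standardPolynomial (K R : Type*) [CommRing K] [Ring R]
    [Algebra K R] (n : ℕ) :
    ∃ f : R [⋀^Fin n]→ₗ[K] R, ∀ v, f v = standardPolynomial n v := by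
  induction n with
  | zero => exact ⟨AlternatingMap.constOfIsEmpty K R (Fin 0) 1, fun v => rfl⟩
  | succ n ih =>
    obtain ⟨f, hf⟩ := ih
    let g : R →ₗ[K] R [⋀^Fin n]→ₗ[K] R :=
      { toFun := fun x => (LinearMap.mulRight K x).compAlternatingMap f
        map_add' := fun x y => by ext; simp [mul_add]
        map_smul' := fun c x => by ext; simp }
    refine ⟨AlternatingMap.alternatizeUncurryFin g, fun v => ?_⟩
    simp [AlternatingMap.alternatizeUncurryFin_apply, g, standardPolynomial, hf]

theorem standardPolynomial_eq_zero_of_finrank_lt {K R : Type*} [Field K] [Ring R] [Algebra K R]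
    [FiniteDimensional K R] {n : ℕ} (hn : Module.finrank K R < n) (v : Fin n → R) :
    standardPolynomial n v = 0 := by
  obtain ⟨f, hf⟩ := exists_alternatingMap_eq_standardPolynomial K R n
  rw [← hf]
  refine f.map_linearDependent v fun h => ?_
  have := h.fintype_card_le_finrank
  rw [Fintype.card_fin] at this
  omega

theorem standardPolynomial_C_mul_X_pow {R : Type*} [Ring R] (n : ℕ) (d : Fin n → R)
    (e : Fin n → ℕ) :
    (standardPolynomial n fun i => C (d i) * X ^ e i) =
      C (standardPolynomial n d) * X ^ ∑ i, e i := by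
  induction n with
  | zero => simp [standardPolynomial]
  | succ n ih =>
    simp only [standardPolynomial, map_sum, Finset.sum_mul]
    refine Finset.sum_congr rfl fun i _ => ?_
    have h := ih (i.removeNth d) (i.removeNth e)
    have h' : i.removeNth (fun j => C (d j) * X ^ e j) =
        fun j => C (i.removeNth d j) * X ^ i.removeNth e j := rfl
    have hX : ∀ (a b : R) (p q : ℕ),
        C a * X ^ p * (C b * X ^ q) = C (a * b) * X ^ (q + p) := by
      intro a b p q
      simp only [C_mul_X_pow_eq_monomial, monomial_mul_monomial, add_comm]
    rw [h', h, hX, Fin.sum_univ_succAbove e i, map_zsmul, smul_mul_assoc]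
    rfl

/-- If `u r = v s` forces `u = 0` in a domain `R` and `s ≠ 0`, then the elements `r s ^ j` are left
linearly independent over `R`. -/
theorem eq_zero_of_sum_mul_mul_pow_eq_zero {R : Type*} [Ring R] [IsDomain R] {r s : R}
    (hs : s ≠ 0) (h : ∀ u v : R, u * r = v * s → u = 0) (n : ℕ) (p : Fin n → R)
    (hp : ∑ i, p i * (r * s ^ (i : ℕ)) = 0) (i : Fin n) : p i = 0 := by
  induction n with
  | zero => exact i.elim0
  | succ n ih =>
    have key : ∑ i : Fin n, p i.succ * (r * s ^ ((i.succ : Fin (n + 1)) : ℕ)) =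
        (∑ i : Fin n, p i.succ * (r * s ^ (i : ℕ))) * s := by
      rw [Finset.sum_mul]
      refine Finset.sum_congr rfl fun i _ => ?_
      simp only [Fin.val_succ, pow_succ, mul_assoc]
    rw [Fin.sum_univ_succ, key] at hp
    simp only [Fin.val_zero, pow_zero, mul_one] at hp
    have h0 : p 0 = 0 := h _ (-∑ i : Fin n, p i.succ * (r * s ^ (i : ℕ))) (by
      rw [neg_mul]; exact eq_neg_of_add_eq_zero_left hp)
    rw [h0, zero_mul, zero_add] at hp
    have := ih (fun i => p i.succ) ((mul_eq_zero.mp hp).resolve_right hs)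
    exact Fin.cases h0 this i

theorem exists_mul_eq_mul_of_standardPolynomial_eq_zero {R : Type*} [Ring R] [IsDomain R] {r s : R}
    (hs : s ≠ 0) (n : ℕ) (hn : (standardPolynomial n fun i => r * s ^ (i : ℕ)) = 0) :
    ∃ u v : R, u ≠ 0 ∧ u * r = v * s := by
  by_contra! hcon
  have h : ∀ u v : R, u * r = v * s → u = 0 := fun u v huv =>
    by_contra fun hu => hcon u v hu huv
  induction n with
  | zero => exact one_ne_zero hn
  | succ n ih =>
    simp only [standardPolynomial, ← smul_mul_assoc] at hn
    have := eq_zero_of_sum_mul_mul_pow_eq_zero hs h _ _ hn (Fin.last n)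
    rw [Fin.removeNth_last] at this
    refine ih ?_
    rcases neg_one_pow_eq_or ℤ n with h1 | h1 <;>
      simpa [h1, Fin.init_def] using this

/-- Let `k` be a field, let `D` be a division ring containing `k` in its
centre and finite dimensional over its centre (the centre being witnessed by a field `Z`
mapping onto `Set.center D`), and let `D[t]` be the polynomial ring over `D`, graded so that
elements of `D·tⁿ` are homogeneous of degree `n`.  Then every graded `k`-subalgebra `A` of
`D[t]` satisfies the graded left Ore conditions with respect to the multiplicative set `S` of
its nonzero homogeneous elements:
(i) if `r ∈ A` is homogeneous, `s ∈ S` and `r·s = 0`, then `s'·r = 0` for some `s' ∈ S`; and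
(ii) for every homogeneous `r ∈ A` and every `s ∈ S` there exist a homogeneous `r' ∈ A` and
`s' ∈ S` with `s'·r = r'·s`. -/
theorem graded_subalgebra_of_polynomial_ring_over_division_ring_satisfies_graded_ore
    (k : Type*) [Field k]
    (D : Type*) [DivisionRing D] [Algebra k D]
    -- `D` is finite dimensional over its centre `Z`
    (Z : Type*) [Field Z] [Algebra k Z] [Algebra Z D] [IsScalarTower k Z D]
    (hZ : Set.range (algebraMap Z D) = Set.center D)
    [FiniteDimensional Z D]
    -- `A` is a graded `k`-subalgebra of `D[t]`
    (A : Subalgebra k (Polynomial D))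
    (hgraded : ∀ p ∈ A, ∀ n : ℕ, (Polynomial.C (p.coeff n) * Polynomial.X ^ n) ∈ A) :
    -- (i)
    (∀ r ∈ A, r.IsHomogeneousElem → ∀ s ∈ A, s.IsHomogeneousElem → s ≠ 0 → r * s = 0 →
      ∃ s' ∈ A, Polynomial.IsHomogeneousElem s' ∧ s' ≠ 0 ∧ s' * r = 0) ∧
    -- (ii)
    (∀ r ∈ A, r.IsHomogeneousElem → ∀ s ∈ A, s.IsHomogeneousElem → s ≠ 0 →
      ∃ r' ∈ A, Polynomial.IsHomogeneousElem r' ∧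
        ∃ s' ∈ A, Polynomial.IsHomogeneousElem s' ∧ s' ≠ 0 ∧ s' * r = r' * s) := by
  refine ⟨fun r _ _ s hsA hs hs0 hrs => ⟨s, hsA, hs, hs0, ?_⟩, ?_⟩
  · rw [(mul_eq_zero.mp hrs).resolve_right hs0, mul_zero]
  rintro r hrA ⟨m, a, rfl⟩ s hsA ⟨n, b, rfl⟩ hs0
  have hpow : ∀ i : ℕ, C a * X ^ m * (C b * X ^ n) ^ i = C (a * b ^ i) * X ^ (m + n * i) := by
    intro i
    simp only [C_mul_X_pow_eq_monomial, monomial_pow, monomial_mul_monomial]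
  obtain ⟨u, v, hu, huv⟩ := exists_mul_eq_mul_of_standardPolynomial_eq_zero
    (R := A) (r := ⟨_, hrA⟩) (s := ⟨_, hsA⟩) (fun h => hs0 (congrArg Subtype.val h))
    (Module.finrank Z D + 1) (by
      apply Subtype.val_injective
      refine (map_standardPolynomial A.val.toRingHom _ _).trans ?_
      change (standardPolynomial _ fun i : Fin _ => C a * X ^ m * (C b * X ^ n) ^ (i : ℕ)) = 0
      simp only [hpow]
      rw [standardPolynomial_C_mul_X_pow,
        standardPolynomial_eq_zero_of_finrank_lt (K := Z) (Nat.lt_succ_self _), map_zero, zero_mul])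
  obtain ⟨u, huA⟩ := u
  obtain ⟨v, hvA⟩ := v
  replace huv : u * (C a * X ^ m) = v * (C b * X ^ n) := congrArg Subtype.val huv
  obtain ⟨i, hi⟩ : ∃ i, u.coeff i ≠ 0 := by
    by_contra! h
    exact hu (Subtype.ext (Polynomial.ext h))
  have hs' : C (u.coeff i) * X ^ i ≠ 0 := by
    rw [C_mul_X_pow_eq_monomial]
    exact fun h => hi ((monomial_eq_zero_iff _ _).mp h)
  have hc := congrArg (fun p => p.coeff (i + m)) huv
  simp only [← mul_assoc, coeff_mul_X_pow', coeff_mul_C, Nat.le_add_left, if_true,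
    Nat.add_sub_cancel] at hc
  split_ifs at hc with hle
  · refine ⟨_, hgraded v hvA (i + m - n), ⟨_, _, rfl⟩, _, hgraded u huA i, ⟨_, _, rfl⟩, hs', ?_⟩
    simp only [C_mul_X_pow_eq_monomial, monomial_mul_monomial, hc, Nat.sub_add_cancel hle]
  · refine ⟨0, A.zero_mem, ⟨0, 0, by simp⟩, _, hgraded u huA i, ⟨_, _, rfl⟩, hs', ?_⟩
    simp only [C_mul_X_pow_eq_monomial, monomial_mul_monomial, hc, map_zero, zero_mul]
end
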